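/- arXiv:1805.07878 — 3 statements merged into one kernel-verified Lean document; each statement's English description precedes it below -/
import Mathlib

section
/- Let G be a connected unbalanced signed graph with n vertices, m edges, a fixed orientation, and a fixed linear order ≺ on its edge set E. For 0 ≤ i ≤ m−n let a_i be the number of subsets F ⊆ E with |F| = i that contain no broken bond of G as a subset. Then for every finite additive abelian group Γ of odd order k, the number of nowhere-zero Γ-flows in G equals Σ_{i=0}^{m−n} (−1)^i · a_i · k^{m−n−i}. -/
/-- A signed graph: each edge `e` has endpoints `a e`, `b e` (equal for a loop)
and a sign `sign e ∈ {1, -1}`. -/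
structure SignedGraph (V E : Type) where
  a : E → V
  b : E → V
  sign : E → ℤ
  sign_unit : ∀ e, sign e = 1 ∨ sign e = -1

namespace SignedGraph

variable {V E : Type}

/-- An orientation of a signed graph: incidence signs `ηa e`, `ηb e ∈ {1,-1}` at the
two ends of each edge, with `ηa e * ηb e = - sign e`. -/
structure Orientation (G : SignedGraph V E) where
  ηa : E → ℤ
  ηb : E → ℤ
  ηa_unit : ∀ e, ηa e = 1 ∨ ηa e = -1
  ηb_unit : ∀ e, ηb e = 1 ∨ ηb e = -1
  compat : ∀ e, ηa e * ηb e = - G.sign e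

/-- Kirchhoff's law at every vertex: a `Γ`-flow. -/
def IsFlow [Fintype E] [DecidableEq V] {Γ : Type} [AddCommGroup Γ]
    (G : SignedGraph V E) (O : G.Orientation) (f : E → Γ) : Prop :=
  ∀ v : V, ∑ e : E,
    ((if G.a e = v then O.ηa e else 0) + (if G.b e = v then O.ηb e else 0)) • f e = 0

/-- Degree of a vertex in the subgraph with edge set `S` (a loop counts twice). -/
def deg [DecidableEq V] (G : SignedGraph V E) (S : Finset E) (v : V) : ℕ :=
  ∑ e ∈ S, ((if G.a e = v then 1 else 0) + (if G.b e = v then 1 else 0))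

/-- Adjacency via an edge in the edge set `S`. -/
def AdjIn (G : SignedGraph V E) (S : Finset E) (v w : V) : Prop :=
  ∃ e ∈ S, (G.a e = v ∧ G.b e = w) ∨ (G.a e = w ∧ G.b e = v)

/-- A circuit: a nonempty edge set forming a connected 2-regular subgraph. -/
def IsCircuit [DecidableEq V] (G : SignedGraph V E) (C : Finset E) : Prop :=
  C.Nonempty ∧
  (∀ v : V, (∃ e ∈ C, G.a e = v ∨ G.b e = v) → G.deg C v = 2) ∧
  (∀ v w : V, (∃ e ∈ C, G.a e = v ∨ G.b e = v) → (∃ e ∈ C, G.a e = w ∨ G.b e = w) →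
     Relation.ReflTransGen (G.AdjIn C) v w)

/-- An unbalanced circuit: a circuit with an odd number of negative edges. -/
def IsUnbalancedCircuit [DecidableEq V] (G : SignedGraph V E) (C : Finset E) : Prop :=
  G.IsCircuit C ∧ Odd (C.filter (fun e => G.sign e = -1)).card

/-- The subgraph with edge set `S` is balanced (contains no unbalanced circuit). -/
def BalancedOn [DecidableEq V] (G : SignedGraph V E) (S : Finset E) : Prop :=
  ∀ C : Finset E, C ⊆ S → ¬ G.IsUnbalancedCircuit C

/-- A balanced signed graph: contains no unbalanced circuit. -/
def Balanced [DecidableEq V] (G : SignedGraph V E) : Prop :=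
  ∀ C : Finset E, ¬ G.IsUnbalancedCircuit C

/-- An unbalanced signed graph: contains an unbalanced circuit. -/
def Unbalanced [DecidableEq V] (G : SignedGraph V E) : Prop :=
  ∃ C : Finset E, G.IsUnbalancedCircuit C

/-- Adjacency in the whole signed graph. -/
def Adj (G : SignedGraph V E) (v w : V) : Prop :=
  ∃ e : E, (G.a e = v ∧ G.b e = w) ∨ (G.a e = w ∧ G.b e = v)

/-- A connected signed graph: every two vertices are joined by a walk. -/
def Connected (G : SignedGraph V E) : Prop :=
  ∀ v w : V, Relation.ReflTransGen G.Adj v w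

/-- The setoid on vertices whose classes are the connected components. -/
def compSetoid (G : SignedGraph V E) : Setoid V :=
  ⟨Relation.EqvGen G.Adj, Relation.EqvGen.is_equivalence _⟩

/-- The connected component of a vertex. -/
def component (G : SignedGraph V E) (v : V) : Quotient G.compSetoid :=
  Quotient.mk G.compSetoid v

/-- The number of vertices of a connected component. -/
noncomputable def compN (G : SignedGraph V E) (q : Quotient G.compSetoid) : ℕ :=
  Nat.card {v : V // G.component v = q}

/-- The number of edges of a connected component. -/
noncomputable def compM (G : SignedGraph V E) (q : Quotient G.compSetoid) : ℕ :=
  Nat.card {e : E // G.component (G.a e) = q}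

/-- The connected component `q` is unbalanced (contains an unbalanced circuit). -/
def CompUnbalanced [DecidableEq V] (G : SignedGraph V E) (q : Quotient G.compSetoid) : Prop :=
  ∃ C : Finset E, G.IsUnbalancedCircuit C ∧ ∃ e ∈ C, G.component (G.a e) = q

open Classical in
/-- `β` of a connected component: `m - n` if unbalanced, `m - n + 1` if balanced. -/
noncomputable def compBeta [DecidableEq V] (G : SignedGraph V E)
    (q : Quotient G.compSetoid) : ℕ :=
  if G.CompUnbalanced q then G.compM q - G.compN q else G.compM q + 1 - G.compN q

/-- `β(G)`: the sum of `β(ω)` over the connected components `ω` of `G`. -/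
noncomputable def beta [DecidableEq V] (G : SignedGraph V E) : ℕ :=
  ∑ᶠ q : Quotient G.compSetoid, G.compBeta q

/-- `κ(G)`: the number of unbalanced connected components of `G`. -/
noncomputable def kappa [DecidableEq V] (G : SignedGraph V E) : ℕ :=
  Nat.card {q : Quotient G.compSetoid // G.CompUnbalanced q}

/-- The signed graph `G - F` obtained by deleting the edges in `F` (all vertices kept). -/
def delete [DecidableEq E] (G : SignedGraph V E) (F : Finset E) :
    SignedGraph V {e : E // e ∉ F} :=
  ⟨fun e => G.a e.1, fun e => G.b e.1, fun e => G.sign e.1, fun e => G.sign_unit e.1⟩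

/-- The edges with both endpoints in `X` (the edge set of `G[X]`). -/
def insideEdges [Fintype E] [DecidableEq V] (G : SignedGraph V E) (X : Finset V) : Finset E :=
  Finset.univ.filter (fun e => G.a e ∈ X ∧ G.b e ∈ X)

/-- The edges with one endpoint in `X` and one outside: `[X, Xᶜ]`. -/
def crossEdges [Fintype E] [DecidableEq V] (G : SignedGraph V E) (X : Finset V) : Finset E :=
  Finset.univ.filter (fun e => (G.a e ∈ X ∧ G.b e ∉ X) ∨ (G.a e ∉ X ∧ G.b e ∈ X))

/-- A cut: a nonempty set `B = [X, Xᶜ] ∪ E_X` where `X` is a nonempty vertex set and `E_X`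
is a set of edges of `G[X]` minimal with `G[X] - E_X` balanced. -/
def IsCut [Fintype E] [DecidableEq V] [DecidableEq E]
    (G : SignedGraph V E) (B : Finset E) : Prop :=
  B.Nonempty ∧ ∃ X : Finset V, X.Nonempty ∧ ∃ EX : Finset E,
    EX ⊆ G.insideEdges X ∧
    G.BalancedOn (G.insideEdges X \ EX) ∧
    (∀ EX' ⊆ EX, G.BalancedOn (G.insideEdges X \ EX') → EX' = EX) ∧
    B = G.crossEdges X ∪ EX

/-- A bond: a cut that is minimal (under inclusion) among cuts. -/
def IsBond [Fintype E] [DecidableEq V] [DecidableEq E]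
    (G : SignedGraph V E) (B : Finset E) : Prop :=
  G.IsCut B ∧ ∀ B' ⊆ B, G.IsCut B' → B' = B

/-- A broken bond: a bond minus its largest edge (w.r.t. the linear order on `E`). -/
def IsBrokenBond [Fintype E] [DecidableEq V] [LinearOrder E]
    (G : SignedGraph V E) (D : Finset E) : Prop :=
  ∃ B : Finset E, G.IsBond B ∧ ∃ h : B.Nonempty, D = B.erase (B.max' h)

/-- `F` contains no broken bond of `G` as a subset. -/
def NoBrokenBond [Fintype E] [DecidableEq V] [LinearOrder E]
    (G : SignedGraph V E) (F : Finset E) : Prop :=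
  ∀ D : Finset E, G.IsBrokenBond D → ¬ D ⊆ F

end SignedGraph

/-- `ε(Γ)`: the largest `d` such that `Γ` has a subgroup isomorphic to `(ℤ/2ℤ)^d`. -/
noncomputable def epsilon (Γ : Type) [AddCommGroup Γ] [Fintype Γ] : ℕ :=
  sSup {d : ℕ | ∃ H : AddSubgroup Γ, Nonempty (H ≃+ (Fin d → ZMod 2))}

namespace SignedGraph

variable {V E : Type}

theorem AdjIn.symm {G : SignedGraph V E} {S : Finset E} {u v : V} (h : G.AdjIn S u v) :
    G.AdjIn S v u := by
  obtain ⟨e, he, h⟩ := h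
  exact ⟨e, he, h.symm⟩

/-- `G.SignedWalk S n s u w`: some walk of length `n` from `u` to `w` with edges in `S` has
product of signs equal to `s`. -/
inductive SignedWalk (G : SignedGraph V E) (S : Finset E) : ℕ → ℤ → V → V → Prop
  | nil (u : V) : SignedWalk G S 0 1 u u
  | cons {n : ℕ} {s : ℤ} {u v w : V} (e : E) (he : e ∈ S)
      (h : (G.a e = u ∧ G.b e = v) ∨ (G.a e = v ∧ G.b e = u)) (p : SignedWalk G S n s v w) :
      SignedWalk G S (n + 1) (G.sign e * s) u w

namespace SignedWalk

variable {G : SignedGraph V E} {S : Finset E} {n m : ℕ} {s t : ℤ} {u v w : V}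

theorem sign_unit (p : G.SignedWalk S n s u w) : s = 1 ∨ s = -1 := by
  induction p with
  | nil => exact Or.inl rfl
  | cons e _ _ _ ih => rcases G.sign_unit e with h | h <;> rcases ih with h' | h' <;> simp [h, h']

theorem append (p : G.SignedWalk S n s u v) (q : G.SignedWalk S m t v w) :
    G.SignedWalk S (n + m) (s * t) u w := by
  induction p with
  | nil => simpa using q
  | cons e he h _ ih =>
    have := SignedWalk.cons e he h (ih q)
    rwa [← mul_assoc, Nat.add_right_comm] at this

theorem single {e : E} (he : e ∈ S)
    (h : (G.a e = u ∧ G.b e = v) ∨ (G.a e = v ∧ G.b e = u)) :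
    G.SignedWalk S 1 (G.sign e) u v := by
  simpa using SignedWalk.cons e he h (SignedWalk.nil v)

theorem reverse (p : G.SignedWalk S n s u w) : G.SignedWalk S n s w u := by
  induction p with
  | nil u => exact .nil u
  | cons e he h _ ih =>
    rw [mul_comm]
    exact ih.append (single he h.symm)

/-- A signed walk is given by its sequences of vertices and edges. -/
theorem exists_sequences (e₀ : E) (p : G.SignedWalk S n s u w) :
    ∃ (x : ℕ → V) (e : ℕ → E), x 0 = u ∧ x n = w ∧
      (∀ i < n, e i ∈ S ∧ ((G.a (e i) = x i ∧ G.b (e i) = x (i + 1)) ∨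
        (G.a (e i) = x (i + 1) ∧ G.b (e i) = x i))) ∧
      ∏ i ∈ Finset.range n, G.sign (e i) = s := by
  induction p with
  | nil u => exact ⟨fun _ => u, fun _ => e₀, rfl, rfl, by simp, by simp⟩
  | @cons n s u v w e he h _ ih =>
    obtain ⟨x, f, hx0, hxn, hf, hs⟩ := ih
    refine ⟨fun i => Nat.casesOn i u x, fun i => Nat.casesOn i e f, rfl, hxn, ?_, ?_⟩
    · rintro (_ | i) hi
      · exact ⟨he, by simpa [hx0] using h⟩
      · exact hf i (by omega)
    · rw [Finset.prod_range_succ', ← hs]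
      exact mul_comm _ _

theorem of_sequences {x : ℕ → V} {e : ℕ → E} (d i : ℕ)
    (h : ∀ t < i + d, e t ∈ S ∧ ((G.a (e t) = x t ∧ G.b (e t) = x (t + 1)) ∨
        (G.a (e t) = x (t + 1) ∧ G.b (e t) = x t))) :
    G.SignedWalk S d (∏ t ∈ Finset.range d, G.sign (e (i + t))) (x i) (x (i + d)) := by
  induction d with
  | zero => simpa using SignedWalk.nil (x i)
  | succ d ih =>
    rw [Finset.prod_range_succ]
    obtain ⟨he, hj⟩ := h (i + d) (by omega)
    exact (ih fun t ht => h t (by omega)).append (single he hj)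

end SignedWalk

theorem prod_sign (G : SignedGraph V E) (C : Finset E) :
    ∏ e ∈ C, G.sign e = (-1) ^ (C.filter (fun e => G.sign e = -1)).card := by
  rw [← Finset.prod_const, Finset.prod_filter]
  refine Finset.prod_congr rfl fun e _ => ?_
  rcases G.sign_unit e with h | h <;> simp [h]

theorem odd_card_negative_iff (G : SignedGraph V E) (C : Finset E) :
    Odd (C.filter (fun e => G.sign e = -1)).card ↔ ∏ e ∈ C, G.sign e = -1 := by
  rw [prod_sign, neg_one_pow_eq_neg_one_iff_odd (by norm_num)]

/-- A shortest closed walk with negative sign runs around an unbalanced circuit. -/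
theorem exists_isUnbalancedCircuit_of_minimal [DecidableEq V] [DecidableEq E]
    {G : SignedGraph V E} {S : Finset E} {L : ℕ}
    (hmin : ∀ l < L, ∀ u, ¬ G.SignedWalk S l (-1) u u) {x : ℕ → V} {e : ℕ → E} (hx : x L = x 0)
    (he : ∀ i < L, e i ∈ S ∧ ((G.a (e i) = x i ∧ G.b (e i) = x (i + 1)) ∨
        (G.a (e i) = x (i + 1) ∧ G.b (e i) = x i)))
    (hs : ∏ i ∈ Finset.range L, G.sign (e i) = -1) :
    ∃ C ⊆ S, G.IsUnbalancedCircuit C := by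
  have hL : 0 < L := by
    rcases Nat.eq_zero_or_pos L with rfl | h
    · simp at hs
    · exact h
  have hxinj : ∀ i j, i < j → j < L → x i ≠ x j := by
    intro i j hij hj hxij
    obtain ⟨d, rfl⟩ := Nat.exists_eq_add_of_lt hij
    obtain ⟨r, rfl⟩ := Nat.exists_eq_add_of_lt hj
    have p₀ := SignedWalk.of_sequences (G := G) (S := S) (x := x) (e := e) i 0
      fun t ht => he t (by omega)
    have p₁ := SignedWalk.of_sequences (G := G) (S := S) (x := x) (e := e) (d + 1) i
      fun t ht => he t (by omega)
    have p₂ := SignedWalk.of_sequences (G := G) (S := S) (x := x) (e := e) (r + 1) (i + (d + 1))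
      fun t ht => he t (by omega)
    rw [show i + d + 1 + r + 1 = i + (d + 1) + (r + 1) by omega] at hs hx
    rw [Finset.prod_range_add, Finset.prod_range_add] at hs
    rw [hx, ← add_assoc, ← hxij] at p₂
    rw [← add_assoc, ← hxij] at p₁
    rw [Nat.zero_add] at p₀
    simp only [Nat.zero_add, ← add_assoc] at p₀ p₁ p₂ hs
    have q := p₀.append p₂
    rcases p₁.sign_unit with h | h
    · rw [h, mul_one] at hs
      rw [hs] at q
      exact hmin _ (by omega) _ q
    · rw [h] at p₁
      exact hmin _ (by omega) _ p₁
  have heinj' : ∀ i j, i < j → j < L → e i ≠ e j := by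
    intro i j hij hj heij
    obtain ⟨-, hi'⟩ := he i (by omega)
    obtain ⟨-, hj'⟩ := he j hj
    rw [heij] at hi'
    have hne := hxinj i j hij hj
    have h : x i = x (j + 1) ∧ x (i + 1) = x j := by
      rcases hi' with ⟨h1, h2⟩ | ⟨h1, h2⟩ <;> rcases hj' with ⟨h3, h4⟩ | ⟨h3, h4⟩
      · exact absurd (h1.symm.trans h3) hne
      · exact ⟨h1.symm.trans h3, h2.symm.trans h4⟩
      · exact ⟨h2.symm.trans h4, h1.symm.trans h3⟩
      · exact absurd (h2.symm.trans h4) hne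
    have hj1 : i + 1 = j := by
      by_contra hc
      exact hxinj (i + 1) j (by omega) hj h.2
    have hjL : j + 1 = L := by
      by_contra hc
      exact hxinj i (j + 1) (by omega) (by omega) h.1
    have hi0 : i = 0 := by
      by_contra hc
      refine hxinj 0 i (by omega) (by omega) ?_
      rw [h.1, hjL, hx]
    subst hi0 hj1 hjL
    rw [Finset.prod_range_succ, Finset.prod_range_one, heij] at hs
    rcases G.sign_unit (e (0 + 1)) with h | h <;> rw [h] at hs <;> norm_num at hs
  have heinj : Set.InjOn e (Finset.range L) := by
    intro i hi j hj hij
    simp only [Finset.coe_range, Set.mem_Iio] at hi hj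
    rcases lt_trichotomy i j with h | h | h
    · exact absurd hij (heinj' i j h hj)
    · exact h
    · exact absurd hij.symm (heinj' j i h hi)
  have hvertex : ∀ v, (∃ f ∈ (Finset.range L).image e, G.a f = v ∨ G.b f = v) →
      ∃ i < L, x i = v := by
    rintro v ⟨f, hf, hv⟩
    obtain ⟨i, hi, rfl⟩ := Finset.mem_image.1 hf
    rw [Finset.mem_range] at hi
    obtain ⟨-, h⟩ := he i hi
    have hv' : x i = v ∨ x (i + 1) = v := by
      rcases h with ⟨h1, h2⟩ | ⟨h1, h2⟩ <;> rw [h1, h2] at hv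
      · exact hv
      · exact hv.symm
    rcases hv' with hv' | hv'
    · exact ⟨i, hi, hv'⟩
    · by_cases hiL : i + 1 < L
      · exact ⟨i + 1, hiL, hv'⟩
      · refine ⟨0, hL, ?_⟩
        rw [← hx, ← hv']
        congr 1
        omega
  refine ⟨(Finset.range L).image e, ?_, ⟨?_, ?_, ?_⟩, ?_⟩
  · intro f hf
    obtain ⟨i, hi, rfl⟩ := Finset.mem_image.1 hf
    exact (he i (Finset.mem_range.1 hi)).1
  · exact ⟨e 0, Finset.mem_image_of_mem _ (Finset.mem_range.2 hL)⟩
  · intro v hv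
    obtain ⟨i, hi, rfl⟩ := hvertex v hv
    have hshift : ∑ j ∈ Finset.range L, (if x (j + 1) = x i then 1 else 0) =
        ∑ j ∈ Finset.range L, (if x j = x i then 1 else 0) := by
      have h1 := Finset.sum_range_succ (fun j => if x j = x i then 1 else 0) L
      have h2 := Finset.sum_range_succ' (fun j => if x j = x i then 1 else 0) L
      rw [hx] at h1
      omega
    have hone : ∑ j ∈ Finset.range L, (if x j = x i then 1 else 0) = 1 := by
      rw [Finset.sum_eq_single i]
      · simp
      · intro j hj hji
        rw [Finset.mem_range] at hj
        rcases lt_or_gt_of_ne hji with h | h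
        · simp [hxinj j i h hi]
        · simp [(hxinj i j h hj).symm]
      · simp [hi]
    rw [deg, Finset.sum_image heinj]
    calc _ = ∑ j ∈ Finset.range L,
          ((if x j = x i then 1 else 0) + (if x (j + 1) = x i then 1 else 0)) := by
          refine Finset.sum_congr rfl fun j hj => ?_
          obtain ⟨-, ⟨h1, h2⟩ | ⟨h1, h2⟩⟩ := he j (Finset.mem_range.1 hj) <;> rw [h1, h2]
          rw [add_comm]
      _ = 2 := by rw [Finset.sum_add_distrib, hshift, hone]
  · have hreach : ∀ i < L, Relation.ReflTransGen (G.AdjIn ((Finset.range L).image e))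
        (x 0) (x i) := by
      intro i
      induction i with
      | zero => exact fun _ => .refl
      | succ i ih =>
        intro hi
        refine (ih (by omega)).tail ⟨e i, ?_, (he i (by omega)).2⟩
        exact Finset.mem_image_of_mem _ (Finset.mem_range.2 (by omega))
    intro v w hv hw
    obtain ⟨i, hi, rfl⟩ := hvertex v hv
    obtain ⟨j, hj, rfl⟩ := hvertex w hw
    have : Std.Symm (G.AdjIn ((Finset.range L).image e)) := ⟨fun _ _ h => h.symm⟩
    exact (Std.Symm.symm _ _ (hreach i hi)).trans (hreach j hj)
  · rw [odd_card_negative_iff, Finset.prod_image heinj, hs]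

theorem SignedWalk.exists_isUnbalancedCircuit [DecidableEq V] {G : SignedGraph V E}
    {S : Finset E} {n : ℕ} {u : V} (p : G.SignedWalk S n (-1) u u) :
    ∃ C ⊆ S, G.IsUnbalancedCircuit C := by
  classical
  have hex : ∃ n, ∃ u, G.SignedWalk S n (-1) u u := ⟨n, u, p⟩
  obtain ⟨v, q⟩ := Nat.find_spec hex
  have hE : Nonempty E := by
    by_contra h
    rw [not_nonempty_iff] at h
    generalize hs : (-1 : ℤ) = s at p
    cases p with
    | nil => norm_num at hs
    | cons e => exact h.elim e
  obtain ⟨x, e, h0, hL, he, hs⟩ := q.exists_sequences hE.some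
  exact exists_isUnbalancedCircuit_of_minimal
    (fun l hl u hu => Nat.find_min hex hl ⟨u, hu⟩) (hL.trans h0.symm) he hs

/-- A set of edges which switches to all-positive edges is balanced. -/
theorem balancedOn_of_switching [Fintype V] [DecidableEq V] {G : SignedGraph V E}
    {S : Finset E} {τ : V → ℤ} (hτ : ∀ v, τ v = 1 ∨ τ v = -1)
    (h : ∀ e ∈ S, G.sign e = τ (G.a e) * τ (G.b e)) : G.BalancedOn S := by
  rintro C hCS ⟨⟨-, hdeg, -⟩, hodd⟩
  rw [odd_card_negative_iff] at hodd
  have key : ∏ e ∈ C, G.sign e = ∏ v, τ v ^ G.deg C v := by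
    simp only [deg, ← Finset.prod_pow_eq_pow_sum]
    rw [Finset.prod_comm]
    refine Finset.prod_congr rfl fun e he => ?_
    simp only [h e (hCS he), pow_add, Finset.prod_mul_distrib, pow_ite, pow_one, pow_zero,
      Finset.prod_ite_eq, Finset.mem_univ, if_true]
  have hone : ∏ v, τ v ^ G.deg C v = 1 := by
    refine Finset.prod_eq_one fun v _ => ?_
    by_cases hv : ∃ e ∈ C, G.a e = v ∨ G.b e = v
    · rw [hdeg v hv]
      rcases hτ v with h | h <;> simp [h]
    · push Not at hv
      have : G.deg C v = 0 := Finset.sum_eq_zero fun e he => by simp [hv e he]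
      rw [this, pow_zero]
  rw [key, hone] at hodd
  norm_num at hodd

theorem eq_of_unit_of_mul_ne_neg_one {x y : ℤ} (hx : x = 1 ∨ x = -1) (hy : y = 1 ∨ y = -1)
    (h : x * y ≠ -1) : x = y := by
  rcases hx with rfl | rfl <;> rcases hy with rfl | rfl <;> simp_all

/-- A balanced set of edges switches to all-positive edges. -/
theorem BalancedOn.exists_switching [DecidableEq V] {G : SignedGraph V E} {S : Finset E}
    (h : G.BalancedOn S) : ∃ τ : V → ℤ, (∀ v, τ v = 1 ∨ τ v = -1) ∧
      ∀ e ∈ S, G.sign e = τ (G.a e) * τ (G.b e) := by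
  have hclosed : ∀ n u, ¬ G.SignedWalk S n (-1) u u := fun n u p => by
    obtain ⟨C, hC, hC'⟩ := p.exists_isUnbalancedCircuit
    exact h C hC hC'
  let r : Setoid V :=
    { r := fun u w => ∃ n s, G.SignedWalk S n s u w
      iseqv :=
        { refl := fun u => ⟨0, 1, .nil u⟩
          symm := fun ⟨n, s, p⟩ => ⟨n, s, p.reverse⟩
          trans := fun ⟨_, _, p⟩ ⟨_, _, q⟩ => ⟨_, _, p.append q⟩ } }
  choose n τ p using fun w : V => Quotient.exact (Quotient.out_eq (Quotient.mk r w))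
  refine ⟨τ, fun v => (p v).sign_unit, fun e he => ?_⟩
  have q := SignedWalk.single (G := G) he (Or.inl ⟨rfl, rfl⟩)
  have hab : Quotient.mk r (G.a e) = Quotient.mk r (G.b e) := Quotient.sound ⟨_, _, q⟩
  have pa := p (G.a e)
  rw [hab] at pa
  have hc := (pa.append q).append (p (G.b e)).reverse
  have := eq_of_unit_of_mul_ne_neg_one (pa.append q).sign_unit (p (G.b e)).sign_unit
    fun h => hclosed _ _ (h ▸ hc)
  rw [← this, ← mul_assoc]
  rcases pa.sign_unit with h | h <;> simp [h]

section Cuts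

variable [DecidableEq V] [Fintype E] [DecidableEq E] {G : SignedGraph V E}

/-- If deleting `F` leaves a vertex through which no closed walk is negative, then `F` contains
a cut. -/
theorem exists_isCut_subset [Fintype V] (hconn : G.Connected) (hunb : G.Unbalanced)
    {F : Finset E} {v : V}
    (hv : ∀ n, ¬ G.SignedWalk Fᶜ n (-1) v v) : ∃ B ⊆ F, G.IsCut B := by
  classical
  let X : Finset V := Finset.univ.filter fun w => ∃ n s, G.SignedWalk Fᶜ n s v w
  have hX : ∀ w, w ∈ X ↔ ∃ n s, G.SignedWalk Fᶜ n s v w := fun w => by simp [X]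
  have hvX : v ∈ X := (hX v).2 ⟨0, 1, .nil v⟩
  have hcross : G.crossEdges X ⊆ F := by
    intro e he
    by_contra heF
    rw [← Finset.mem_compl] at heF
    simp only [crossEdges, Finset.mem_filter, Finset.mem_univ, true_and] at he
    rcases he with ⟨h1, h2⟩ | ⟨h1, h2⟩
    · obtain ⟨n, s, p⟩ := (hX _).1 h1
      exact h2 ((hX _).2 ⟨_, _, p.append (.single heF (Or.inl ⟨rfl, rfl⟩))⟩)
    · obtain ⟨n, s, p⟩ := (hX _).1 h2
      exact h1 ((hX _).2 ⟨_, _, p.append (.single heF (Or.inr ⟨rfl, rfl⟩))⟩)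
  have hτ : ∀ w, ∃ t : ℤ, (t = 1 ∨ t = -1) ∧ (w ∈ X → ∃ n, G.SignedWalk Fᶜ n t v w) := by
    intro w
    by_cases hw : w ∈ X
    · obtain ⟨n, s, p⟩ := (hX w).1 hw
      exact ⟨s, p.sign_unit, fun _ => ⟨n, p⟩⟩
    · exact ⟨1, Or.inl rfl, fun h => absurd h hw⟩
  choose τ hτ hp using hτ
  have hbal : G.BalancedOn (G.insideEdges X \ (F ∩ G.insideEdges X)) := by
    refine balancedOn_of_switching hτ fun e he => ?_
    rw [Finset.sdiff_inter_self_right, Finset.mem_sdiff] at he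
    obtain ⟨he, heF⟩ := he
    simp only [insideEdges, Finset.mem_filter, Finset.mem_univ, true_and] at he
    obtain ⟨n, p⟩ := hp _ he.1
    obtain ⟨m, q⟩ := hp _ he.2
    have p' := p.append (.single (Finset.mem_compl.2 heF) (Or.inl ⟨rfl, rfl⟩))
    have hc := p'.append q.reverse
    rw [← eq_of_unit_of_mul_ne_neg_one p'.sign_unit q.sign_unit fun h => hv _ (h ▸ hc), ← mul_assoc]
    rcases p.sign_unit with h | h <;> simp [h]
  obtain ⟨EX, hEXle, hEX⟩ := exists_minimal_le_of_wellFoundedLT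
    (fun D : Finset E => G.BalancedOn (G.insideEdges X \ D)) _ hbal
  have hEXle : EX ⊆ F ∩ G.insideEdges X := hEXle
  refine ⟨G.crossEdges X ∪ EX, Finset.union_subset hcross (hEXle.trans Finset.inter_subset_left),
    ?_, X, ⟨v, hvX⟩, EX, hEXle.trans Finset.inter_subset_right, hEX.prop, ?_, rfl⟩
  · rw [Finset.nonempty_iff_ne_empty]
    intro hempty
    obtain ⟨hc, hE⟩ := Finset.union_eq_empty.1 hempty
    have hall : ∀ w, w ∈ X := by
      intro w
      induction hconn v w with
      | refl => exact hvX
      | @tail y z _ hyz hy =>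
        by_contra hz
        obtain ⟨e, he⟩ := hyz
        have : e ∈ G.crossEdges X := by
          simp only [crossEdges, Finset.mem_filter, Finset.mem_univ, true_and]
          rcases he with ⟨rfl, rfl⟩ | ⟨rfl, rfl⟩
          · exact Or.inl ⟨hy, hz⟩
          · exact Or.inr ⟨hz, hy⟩
        simp [hc] at this
    obtain ⟨C, hC⟩ := hunb
    refine hEX.prop C (fun e _ => ?_) hC
    simp [hE, insideEdges, hall]
  · intro D hD hDbal
    exact le_antisymm hD (hEX.le_of_le hDbal hD)

theorem IsCut.exists_isBond_subset {B : Finset E} (hB : G.IsCut B) : ∃ B' ⊆ B, G.IsBond B' := by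
  obtain ⟨B', hle, hB'⟩ := exists_minimal_le_of_wellFoundedLT (fun B => G.IsCut B) _ hB
  exact ⟨B', hle, hB'.prop, fun D hD hDcut => le_antisymm hD (hB'.le_of_le hDcut hD)⟩

end Cuts

section Flows

variable [Fintype E] [DecidableEq V] {G : SignedGraph V E} {O : G.Orientation}
  {Γ : Type} [AddCommGroup Γ]

theorem IsFlow.sum_potential_smul [Fintype V] {f : E → Γ} (hf : G.IsFlow O f) (t : V → ℤ) :
    ∑ e, (t (G.a e) * O.ηa e + t (G.b e) * O.ηb e) • f e = 0 := by
  calc _ = ∑ e, ∑ v, (t v * ((if G.a e = v then O.ηa e else 0) +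
          (if G.b e = v then O.ηb e else 0))) • f e := by
        refine Finset.sum_congr rfl fun e _ => ?_
        rw [← Finset.sum_smul]
        simp [mul_add, Finset.sum_add_distrib]
    _ = ∑ v, t v • ∑ e, ((if G.a e = v then O.ηa e else 0) +
          (if G.b e = v then O.ηb e else 0)) • f e := by
        rw [Finset.sum_comm]
        simp only [Finset.smul_sum, mul_smul]
    _ = 0 := Finset.sum_eq_zero fun v _ => by rw [hf v, smul_zero]

theorem eq_zero_of_two_smul_eq_zero [Fintype Γ] (hodd : Odd (Fintype.card Γ)) {g : Γ}
    (h : (2 : ℕ) • g = 0) : g = 0 := by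
  obtain ⟨t, ht⟩ := hodd
  have := card_nsmul_eq_zero (x := g)
  rwa [ht, add_nsmul, mul_comm, mul_nsmul', h, smul_zero, zero_add,
    one_nsmul] at this

/-- A flow that vanishes on all edges of a cut but one vanishes on the remaining edge. -/
theorem IsFlow.eq_zero_of_isCut [Fintype V] [DecidableEq E] [Fintype Γ]
    (hodd : Odd (Fintype.card Γ)) {f : E → Γ} (hf : G.IsFlow O f) {B : Finset E}
    (hB : G.IsCut B) {e : E} (he : e ∈ B) (hz : ∀ e' ∈ B.erase e, f e' = 0) : f e = 0 := by
  obtain ⟨-, X, -, EX, hEX, hbal, hmin, rfl⟩ := hB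
  obtain ⟨τ, hτ, hsw⟩ := hbal.exists_switching
  have hsum := hf.sum_potential_smul fun v => if v ∈ X then τ v else 0
  have hcoef : ∀ e', G.sign e' = τ (G.a e') * τ (G.b e') ↔
      τ (G.a e') * O.ηa e' + τ (G.b e') * O.ηb e' = 0 := by
    intro e'
    have hc := O.compat e'
    rcases hτ (G.a e') with h1 | h1 <;> rcases hτ (G.b e') with h2 | h2 <;>
    rcases O.ηa_unit e' with h3 | h3 <;> rcases O.ηb_unit e' with h4 | h4 <;>
    rw [h3, h4] at hc <;> rw [h1, h2, h3, h4] <;> constructor <;> intro h <;> omega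
  rw [Finset.sum_eq_single e] at hsum
  · rcases Finset.mem_union.1 he with he | he
    · simp only [crossEdges, Finset.mem_filter, Finset.mem_univ, true_and] at he
      rcases he with ⟨h1, h2⟩ | ⟨h1, h2⟩
      · rcases hτ (G.a e) with h3 | h3 <;> rcases O.ηa_unit e with h4 | h4 <;>
        simpa [h1, h2, h3, h4] using hsum
      · rcases hτ (G.b e) with h3 | h3 <;> rcases O.ηb_unit e with h4 | h4 <;>
        simpa [h1, h2, h3, h4] using hsum
    · have hin := hEX he
      simp only [insideEdges, Finset.mem_filter, Finset.mem_univ, true_and] at hin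
      have hne : τ (G.a e) * O.ηa e + τ (G.b e) * O.ηb e ≠ 0 := by
        rw [Ne, ← hcoef]
        intro hs
        have := hmin (EX.erase e) (Finset.erase_subset _ _) (balancedOn_of_switching hτ ?_)
        · exact Finset.erase_ne_self.2 he this
        · intro e' he'
          by_cases h : e' = e
          · exact h ▸ hs
          · simp only [Finset.mem_sdiff, Finset.mem_erase, not_and] at he'
            exact hsw e' (Finset.mem_sdiff.2 ⟨he'.1, he'.2 h⟩)
      rw [if_pos hin.1, if_pos hin.2] at hsum
      have htwo : τ (G.a e) * O.ηa e + τ (G.b e) * O.ηb e = 2 ∨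
          τ (G.a e) * O.ηa e + τ (G.b e) * O.ηb e = -2 := by
        rcases hτ (G.a e) with h1 | h1 <;> rcases hτ (G.b e) with h2 | h2 <;>
        rcases O.ηa_unit e with h3 | h3 <;> rcases O.ηb_unit e with h4 | h4 <;>
        rw [h1, h2, h3, h4] at hne ⊢ <;> omega
      refine eq_zero_of_two_smul_eq_zero hodd ?_
      rw [← natCast_zsmul]
      rcases htwo with h | h <;> rw [h] at hsum
      · exact hsum
      · rwa [neg_smul, neg_eq_zero] at hsum
  · intro e' _ hne
    by_cases heB : e' ∈ G.crossEdges X ∪ EX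
    · rw [hz e' (Finset.mem_erase.2 ⟨hne, heB⟩), smul_zero]
    · rw [Finset.mem_union, not_or] at heB
      obtain ⟨hc, hE⟩ := heB
      simp only [crossEdges, Finset.mem_filter, Finset.mem_univ, true_and] at hc
      by_cases ha : G.a e' ∈ X
      · have hb : G.b e' ∈ X := by tauto
        have hs := hsw e' (by simp [insideEdges, ha, hb, hE])
        rw [if_pos ha, if_pos hb, (hcoef e').1 hs, zero_smul]
      · have hb : G.b e' ∉ X := by tauto
        simp [ha, hb]
  · simp

/-- The boundary map on `Γ`-valued functions on the edges outside `F`. -/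
def boundary (G : SignedGraph V E) (O : G.Orientation) (Γ : Type) [AddCommGroup Γ]
    [DecidableEq E] (F : Finset E) : ({e // e ∉ F} → Γ) →+ (V → Γ) where
  toFun f v := ∑ e : {e // e ∉ F}, ((if G.a e = v then O.ηa e else 0) +
    (if G.b e = v then O.ηb e else 0)) • f e
  map_zero' := by ext; simp
  map_add' f g := by ext; simp [smul_add, Finset.sum_add_distrib]

theorem single_sub_mem_range_boundary [DecidableEq E] {F : Finset E} {n : ℕ} {s : ℤ} {u w : V}
    (p : G.SignedWalk Fᶜ n s u w) (g : Γ) :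
    (Pi.single u g - s • Pi.single w g : V → Γ) ∈ (G.boundary O Γ F).range := by
  induction p with
  | nil => simp [zero_mem]
  | @cons n s u v w e he h _ ih =>
    have hedge : (Pi.single u g - G.sign e • Pi.single v g : V → Γ) ∈
        (G.boundary O Γ F).range := by
      have hmem : ∀ c : ℤ, (c • (O.ηa e • Pi.single (G.a e) g + O.ηb e • Pi.single (G.b e) g) :
          V → Γ) ∈ (G.boundary O Γ F).range := by
        refine fun c => zsmul_mem
          (AddMonoidHom.mem_range.2 ⟨Pi.single ⟨e, Finset.mem_compl.1 he⟩ g, ?_⟩) c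
        ext x
        simp only [boundary, AddMonoidHom.coe_mk, ZeroHom.coe_mk]
        rw [Finset.sum_eq_single ⟨e, Finset.mem_compl.1 he⟩]
        · simp [add_smul, ite_smul, Pi.single_apply, eq_comm]
        · intro e' _ hne
          simp [hne]
        · simp
      have hc := O.compat e
      rcases h with ⟨rfl, rfl⟩ | ⟨rfl, rfl⟩
      · convert hmem (O.ηa e) using 1
        rw [smul_add, smul_smul, smul_smul, hc]
        rcases O.ηa_unit e with h | h <;> simp [h, sub_eq_add_neg]
      · convert hmem (O.ηb e) using 1
        rw [smul_add, smul_smul, smul_smul, mul_comm (O.ηb e), hc]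
        rcases O.ηb_unit e with h | h <;> simp [h, sub_eq_add_neg, add_comm]
    have := add_mem hedge (zsmul_mem ih (G.sign e))
    rwa [smul_sub, smul_smul, sub_add_sub_cancel] at this

theorem boundary_surjective [Fintype V] [DecidableEq E] [Fintype Γ]
    (hodd : Odd (Fintype.card Γ)) {F : Finset E}
    (hF : ∀ v, ∃ n, G.SignedWalk Fᶜ n (-1) v v) :
    Function.Surjective (G.boundary O Γ F) := by
  rw [← AddMonoidHom.range_eq_top, eq_top_iff]
  intro y _
  rw [← Finset.univ_sum_single y]
  refine sum_mem fun v _ => ?_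
  obtain ⟨n, p⟩ := hF v
  obtain ⟨t, ht⟩ := hodd
  have hhalf : y v = (t + 1) • y v + (t + 1) • y v := by
    have := card_nsmul_eq_zero (x := y v)
    rw [ht] at this
    rw [← add_nsmul, show t + 1 + (t + 1) = 2 * t + 1 + 1 by ring, succ_nsmul, this, zero_add]
  have := single_sub_mem_range_boundary (O := O) p ((t + 1) • y v)
  rwa [neg_smul, one_smul, sub_neg_eq_add, ← Pi.single_add, ← hhalf] at this

theorem card_flows_vanishing_on [Fintype V] [DecidableEq E] [Fintype Γ]
    (hodd : Odd (Fintype.card Γ)) {F : Finset E}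
    (hF : ∀ v, ∃ n, G.SignedWalk Fᶜ n (-1) v v) :
    Nat.card {f : E → Γ // G.IsFlow O f ∧ ∀ e ∈ F, f e = 0} *
      Fintype.card Γ ^ Fintype.card V = Fintype.card Γ ^ (Fintype.card E - F.card) := by
  have hext : ∀ (f : E → Γ), (∀ e ∈ F, f e = 0) → ∀ v,
      ∑ e : {e // e ∉ F}, ((if G.a e = v then O.ηa e else 0) +
        (if G.b e = v then O.ηb e else 0)) • f e =
      ∑ e, ((if G.a e = v then O.ηa e else 0) + (if G.b e = v then O.ηb e else 0)) • f e := by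
    intro f hf v
    rw [← Finset.sum_subtype (p := fun e => e ∉ F) Fᶜ (by simp) fun e =>
      ((if G.a e = v then O.ηa e else 0) + (if G.b e = v then O.ηb e else 0)) • f e]
    refine Finset.sum_subset (Finset.subset_univ _) fun e _ he => ?_
    rw [hf e (by simpa using he), smul_zero]
  let φ : {f : E → Γ // G.IsFlow O f ∧ ∀ e ∈ F, f e = 0} ≃ (G.boundary O Γ F).ker :=
    { toFun := fun f => ⟨fun e => f.1 e, by
        rw [AddMonoidHom.mem_ker]
        ext v
        exact (hext f.1 f.2.2 v).trans (f.2.1 v)⟩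
      invFun := fun g => ⟨fun e => if h : e ∉ F then g.1 ⟨e, h⟩ else 0, by
        have hz : ∀ e ∈ F, (if h : e ∉ F then g.1 ⟨e, h⟩ else 0) = 0 := fun e he => by simp [he]
        refine ⟨fun v => ?_, hz⟩
        rw [← hext _ hz v]
        refine Eq.trans ?_ (congrFun (AddMonoidHom.mem_ker.1 g.2) v)
        refine Finset.sum_congr rfl fun e _ => ?_
        simp [e.2]⟩
      left_inv := fun f => by
        ext e
        by_cases h : e ∈ F
        · simp [h, f.2.2 e h]
        · simp [h]
      right_inv := fun g => by
        ext e
        simp [e.2] }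
  rw [Nat.card_congr φ]
  have h1 := AddSubgroup.card_eq_card_quotient_mul_card_addSubgroup (G.boundary O Γ F).ker
  have h2 := Nat.card_congr (QuotientAddGroup.quotientKerEquivOfSurjective _
    (boundary_surjective (O := O) hodd hF)).toEquiv
  rw [h2, mul_comm] at h1
  simpa [Nat.card_eq_fintype_card, Fintype.card_subtype_compl] using h1.symm

/-- Inclusion-exclusion for nowhere-zero flows. -/
theorem card_nowhere_zero_flows [Fintype V] [DecidableEq E] [Fintype Γ] :
    (Nat.card {f : E → Γ // G.IsFlow O f ∧ ∀ e, f e ≠ 0} : ℤ) =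
      ∑ F : Finset E, (-1) ^ F.card *
        (Nat.card {f : E → Γ // G.IsFlow O f ∧ ∀ e ∈ F, f e = 0} : ℤ) := by
  classical
  simp only [Nat.card_eq_fintype_card, Fintype.card_subtype, Finset.card_filter, Nat.cast_sum,
    Finset.mul_sum]
  rw [Finset.sum_comm]
  refine Finset.sum_congr rfl fun f _ => ?_
  by_cases hf : G.IsFlow O f
  · have h := Finset.sum_powerset_neg_one_pow_card (x := Finset.univ.filter fun e => f e = 0)
    have hz : (Finset.univ.filter fun e => f e = 0) = ∅ ↔ ∀ e, f e ≠ 0 := by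
      simp [Finset.filter_eq_empty_iff]
    have hp : (Finset.univ.filter fun e => f e = 0).powerset =
        Finset.univ.filter fun F : Finset E => ∀ e ∈ F, f e = 0 := by
      ext F
      simp [Finset.subset_iff]
    rw [hp, Finset.sum_filter] at h
    simp only [hz] at h
    simp only [hf, true_and]
    push_cast
    rw [← h]
    simp
  · simp [hf]

end Flows

theorem mem_symmDiff_singleton_iff [DecidableEq E] {F : Finset E} {e x : E} (hx : x ≠ e) :
    x ∈ F ↔ x ∈ symmDiff F {e} := by
  simp [Finset.mem_symmDiff, hx]

theorem neg_one_pow_card_symmDiff_singleton [DecidableEq E] (F : Finset E) (e : E) :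
    (-1 : ℤ) ^ (symmDiff F {e}).card = -(-1) ^ F.card := by
  by_cases he : e ∈ F
  · have : symmDiff F {e} = F.erase e := by
      ext x
      by_cases hx : x = e <;> simp [Finset.mem_symmDiff, hx, he]
    rw [this, ← Finset.card_erase_add_one he, pow_succ]
    ring
  · have : symmDiff F {e} = insert e F := by
      ext x
      by_cases hx : x = e <;> simp [Finset.mem_symmDiff, hx, he]
    rw [this, Finset.card_insert_of_notMem he, pow_succ]
    ring

section BrokenBonds

variable [DecidableEq V] [Fintype E] [LinearOrder E] {G : SignedGraph V E}

theorem NoBrokenBond.exists_signedWalk [Fintype V] (hconn : G.Connected) (hunb : G.Unbalanced)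
    {F : Finset E} (hF : G.NoBrokenBond F) (v : V) : ∃ n, G.SignedWalk Fᶜ n (-1) v v := by
  by_contra! h
  obtain ⟨B, hBF, hB⟩ := exists_isCut_subset hconn hunb h
  obtain ⟨B', hB'B, hB'⟩ := hB.exists_isBond_subset
  exact hF _ ⟨B', hB', hB'.1.1, rfl⟩ ((Finset.erase_subset _ _).trans (hB'B.trans hBF))

open Classical in
/-- The largest edges of the bonds whose broken bond lies in `F`. -/
noncomputable def brokenMaxima (G : SignedGraph V E) (F : Finset E) : Finset E :=
  Finset.univ.filter fun e => ∃ B, G.IsBond B ∧ ∃ h : B.Nonempty, B.max' h = e ∧ B.erase e ⊆ F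

theorem mem_brokenMaxima {F : Finset E} {e : E} : e ∈ G.brokenMaxima F ↔
    ∃ B, G.IsBond B ∧ ∃ h : B.Nonempty, B.max' h = e ∧ B.erase e ⊆ F := by
  simp [brokenMaxima]

theorem brokenMaxima_nonempty_iff {F : Finset E} :
    (G.brokenMaxima F).Nonempty ↔ ¬ G.NoBrokenBond F := by
  simp only [NoBrokenBond, IsBrokenBond, not_forall, not_not, Finset.Nonempty, mem_brokenMaxima]
  constructor
  · rintro ⟨_, B, hB, h, rfl, hF⟩
    exact ⟨_, ⟨B, hB, h, rfl⟩, hF⟩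
  · rintro ⟨_, ⟨B, hB, h, rfl⟩, hF⟩
    exact ⟨_, B, hB, h, rfl, hF⟩

theorem mem_brokenMaxima_of_le {F F' : Finset E} {e e' : E}
    (hFF' : ∀ x, x ≠ e → (x ∈ F ↔ x ∈ F')) (hle : e' ≤ e) (he' : e' ∈ G.brokenMaxima F) :
    e' ∈ G.brokenMaxima F' := by
  obtain ⟨B, hB, h, rfl, hF⟩ := mem_brokenMaxima.1 he'
  refine mem_brokenMaxima.2 ⟨B, hB, h, rfl, fun x hx => (hFF' x ?_).1 (hF hx)⟩
  rintro rfl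
  obtain ⟨hne, hx⟩ := Finset.mem_erase.1 hx
  exact hne (le_antisymm (B.le_max' x hx) hle)

theorem brokenMaxima_symmDiff_min' {F : Finset E} (h : (G.brokenMaxima F).Nonempty)
    (h' : (G.brokenMaxima (symmDiff F {(G.brokenMaxima F).min' h})).Nonempty) :
    (G.brokenMaxima (symmDiff F {(G.brokenMaxima F).min' h})).min' h' =
      (G.brokenMaxima F).min' h := by
  have hle : (G.brokenMaxima (symmDiff F {(G.brokenMaxima F).min' h})).min' h' ≤
      (G.brokenMaxima F).min' h :=
    Finset.min'_le _ _ (mem_brokenMaxima_of_le (fun _ => mem_symmDiff_singleton_iff) le_rfl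
      (Finset.min'_mem _ h))
  refine le_antisymm hle (Finset.min'_le _ _ ?_)
  exact mem_brokenMaxima_of_le (fun _ hx => (mem_symmDiff_singleton_iff hx).symm) hle
    (Finset.min'_mem _ h')

theorem card_flows_symmDiff_of_mem_brokenMaxima [Fintype V] {O : G.Orientation} {Γ : Type}
    [AddCommGroup Γ]
    [Fintype Γ] (hodd : Odd (Fintype.card Γ)) {F : Finset E} {e : E}
    (he : e ∈ G.brokenMaxima F) :
    Nat.card {f : E → Γ // G.IsFlow O f ∧ ∀ x ∈ symmDiff F {e}, f x = 0} =
      Nat.card {f : E → Γ // G.IsFlow O f ∧ ∀ x ∈ F, f x = 0} := by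
  have key : ∀ F F' : Finset E, (∀ x, x ≠ e → (x ∈ F ↔ x ∈ F')) → e ∈ G.brokenMaxima F →
      ∀ f : E → Γ, G.IsFlow O f → (∀ x ∈ F, f x = 0) → ∀ x ∈ F', f x = 0 := by
    intro F F' hFF' he f hf hz x hx
    by_cases hxe : x = e
    · obtain ⟨B, hB, h, hmax, hBF⟩ := mem_brokenMaxima.1 he
      have heB : x ∈ B := by
        rw [hxe, ← hmax]
        exact B.max'_mem h
      exact hf.eq_zero_of_isCut hodd hB.1 heB fun y hy => hz y (hBF (hxe ▸ hy))
    · exact hz x ((hFF' x hxe).2 hx)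
  refine Nat.card_congr (Equiv.subtypeEquivRight fun f => and_congr_right fun hf => ⟨?_, ?_⟩)
  · exact key _ _ (fun _ hx => (mem_symmDiff_singleton_iff hx).symm)
      (mem_brokenMaxima_of_le (fun _ => mem_symmDiff_singleton_iff) le_rfl he) f hf
  · exact key _ _ (fun _ => mem_symmDiff_singleton_iff) he f hf

open Classical in
/-- The sets containing a broken bond cancel in the inclusion-exclusion sum. -/
theorem sum_brokenBond_eq_zero [Fintype V] (O : G.Orientation) {Γ : Type} [AddCommGroup Γ]
    [Fintype Γ] (hodd : Odd (Fintype.card Γ)) :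
    ∑ F : Finset E with ¬ G.NoBrokenBond F, (-1) ^ F.card *
      (Nat.card {f : E → Γ // G.IsFlow O f ∧ ∀ e ∈ F, f e = 0} : ℤ) = 0 := by
  have hne : ∀ F ∈ (Finset.univ.filter fun F : Finset E => ¬ G.NoBrokenBond F),
      (G.brokenMaxima F).Nonempty := fun F hF =>
    brokenMaxima_nonempty_iff.2 (Finset.mem_filter.1 hF).2
  refine Finset.sum_involution
    (fun F hF => symmDiff F {(G.brokenMaxima F).min' (hne F hF)}) ?_ ?_ ?_ ?_
  · intro F hF
    rw [neg_one_pow_card_symmDiff_singleton,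
      card_flows_symmDiff_of_mem_brokenMaxima hodd (Finset.min'_mem _ (hne F hF))]
    ring
  · intro F hF _ h
    simp at h
  · intro F hF
    refine Finset.mem_filter.2 ⟨Finset.mem_univ _, brokenMaxima_nonempty_iff.1
      ⟨(G.brokenMaxima F).min' (hne F hF), ?_⟩⟩
    exact mem_brokenMaxima_of_le (fun _ => mem_symmDiff_singleton_iff) le_rfl
      (Finset.min'_mem _ (hne F hF))
  · intro F hF
    rw [brokenMaxima_symmDiff_min' (hne F hF), symmDiff_symmDiff_cancel_right]

end BrokenBonds

end SignedGraph

/-- Coefficients of the flow polynomial: for a connected unbalanced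
signed graph `G` with `n` vertices and `m` edges, and `a_i` the number of `i`-element edge
sets containing no broken bond, the number of nowhere-zero `Γ`-flows (for `Γ` of odd
order `k`) is `∑_{i=0}^{m-n} (-1)^i a_i k^{m-n-i}`. -/
theorem nowhere_zero_flow_count_coefficients {V E : Type}
    [Fintype V] [DecidableEq V] [Fintype E] [LinearOrder E]
    (G : SignedGraph V E) (O : G.Orientation)
    (hconn : G.Connected) (hunb : G.Unbalanced)
    (n m : ℕ) (hn : n = Fintype.card V) (hm : m = Fintype.card E)
    (a : ℕ → ℕ)
    (ha : ∀ i, a i = Nat.card {F : Finset E // F.card = i ∧ G.NoBrokenBond F})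
    (Γ : Type) [AddCommGroup Γ] [Fintype Γ] (k : ℕ) (hk : Fintype.card Γ = k)
    (hodd : Odd k) :
    (Nat.card {f : E → Γ // G.IsFlow O f ∧ ∀ e, f e ≠ 0} : ℤ) =
      ∑ i ∈ Finset.range (m - n + 1),
        (-1 : ℤ) ^ i * (a i : ℤ) * (k : ℤ) ^ (m - n - i) := by
  classical
  subst hn hm hk
  have hpow : ∀ F : Finset E, G.NoBrokenBond F →
      F.card ≤ Fintype.card E - Fintype.card V ∧
      (Nat.card {f : E → Γ // G.IsFlow O f ∧ ∀ e ∈ F, f e = 0} : ℤ) =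
        (Fintype.card Γ : ℤ) ^ (Fintype.card E - Fintype.card V - F.card) := by
    intro F hF
    have hwalk := hF.exists_signedWalk hconn hunb
    have hle : Fintype.card V + F.card ≤ Fintype.card E := by
      -- the count over `ZMod 3` bounds the number of vertices, even when `Γ` is trivial
      have h3 := SignedGraph.card_flows_vanishing_on (O := O) (Γ := ZMod 3) (by decide) hwalk
      have hF' := Finset.card_le_univ F
      rw [ZMod.card] at h3
      have := (Nat.pow_dvd_pow_iff_le_right (by norm_num)).1 (Dvd.intro_left _ h3)
      omega
    refine ⟨by omega, ?_⟩
    have h := SignedGraph.card_flows_vanishing_on (O := O) hodd hwalk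
    rw [show Fintype.card E - F.card =
      Fintype.card E - Fintype.card V - F.card + Fintype.card V by omega, pow_add] at h
    exact_mod_cast Nat.eq_of_mul_eq_mul_right (pow_pos Fintype.card_pos _) h
  rw [SignedGraph.card_nowhere_zero_flows,
    ← Finset.sum_filter_add_sum_filter_not _ (fun F => G.NoBrokenBond F),
    SignedGraph.sum_brokenBond_eq_zero O hodd, add_zero,
    ← Finset.sum_fiberwise_of_maps_to (g := Finset.card)
      (t := Finset.range (Fintype.card E - Fintype.card V + 1))
      (fun F hF => Finset.mem_range_succ_iff.2 (hpow F (Finset.mem_filter.1 hF).2).1)]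
  refine Finset.sum_congr rfl fun i _ => ?_
  rw [Finset.sum_congr rfl (g := fun _ => (-1 : ℤ) ^ i *
    (Fintype.card Γ : ℤ) ^ (Fintype.card E - Fintype.card V - i))]
  · rw [Finset.sum_const, ha, Nat.card_eq_fintype_card, Fintype.card_subtype, Finset.filter_filter,
      Finset.filter_congr fun F _ => and_comm, nsmul_eq_mul]
    ring
  · intro F hF
    simp only [Finset.mem_filter, Finset.mem_univ, true_and] at hF
    rw [(hpow F hF.1).2, hF.2]
end

section
/- Let G be a connected unbalanced signed graph with n vertices, m edges, and a fixed linear order ≺ on its edge set E, and suppose that no bond of G consists of a single edge. Then for every integer i with 0 ≤ i ≤ m−n there exists a subset F ⊆ E with |F| = i that contains no broken bond of G as a subset. -/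
namespace SignedGraph

variable {V E : Type}

/-- The mod-2 incidence vector of an edge; a loop gives the zero vector. -/
def parityVec [DecidableEq V] (G : SignedGraph V E) (e : E) (v : V) : ZMod 2 :=
  (if G.a e = v then 1 else 0) + (if G.b e = v then 1 else 0)

/-- The sign of an edge as an element of `ZMod 2`. -/
def signBit (G : SignedGraph V E) (e : E) : ZMod 2 :=
  if G.sign e = -1 then 1 else 0

/-- All degrees in the subgraph with edge set `C` are even. -/
def IsEven [DecidableEq V] (G : SignedGraph V E) (C : Finset E) : Prop :=
  ∀ v, ∑ e ∈ C, G.parityVec e v = 0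

lemma sum_parityVec [DecidableEq V] (G : SignedGraph V E) (C : Finset E) (v : V) :
    ∑ e ∈ C, G.parityVec e v = (G.deg C v : ZMod 2) := by
  simp [deg, parityVec]

lemma sum_signBit (G : SignedGraph V E) (C : Finset E) :
    ∑ e ∈ C, G.signBit e = ((C.filter (fun e => G.sign e = -1)).card : ZMod 2) := by
  simp [signBit]

lemma sum_mul_parityVec [Fintype V] [DecidableEq V] (G : SignedGraph V E) (φ : V → ZMod 2)
    (e : E) : ∑ v, φ v * G.parityVec e v = φ (G.a e) + φ (G.b e) := by
  simp [parityVec, mul_add, Finset.sum_add_distrib]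

lemma deg_pos [DecidableEq V] (G : SignedGraph V E) {C : Finset E} {v : V}
    (h : ∃ e ∈ C, G.a e = v ∨ G.b e = v) : 0 < G.deg C v := by
  obtain ⟨e, he, h⟩ := h
  refine Finset.sum_pos' (fun _ _ => Nat.zero_le _) ⟨e, he, ?_⟩
  rcases h with h | h <;> simp [h]

lemma deg_eq_zero [DecidableEq V] (G : SignedGraph V E) {C : Finset E} {v : V}
    (h : ¬ ∃ e ∈ C, G.a e = v ∨ G.b e = v) : G.deg C v = 0 := by
  push Not at h
  exact Finset.sum_eq_zero fun e he => by simp [h e he]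

lemma sum_deg [Fintype V] [DecidableEq V] (G : SignedGraph V E) (C : Finset E) :
    ∑ v, G.deg C v = 2 * C.card := by
  simp only [deg]
  rw [Finset.sum_comm]
  simp [Finset.sum_add_distrib, mul_two, two_mul]

lemma IsCircuit.isEven [DecidableEq V] {G : SignedGraph V E} {C : Finset E}
    (hC : G.IsCircuit C) : G.IsEven C := by
  intro v
  rw [sum_parityVec]
  by_cases h : ∃ e ∈ C, G.a e = v ∨ G.b e = v
  · rw [hC.2.1 v h]; rfl
  · rw [G.deg_eq_zero h]; rfl

lemma balancedOn_of_potential [Fintype V] [DecidableEq V] (G : SignedGraph V E) {S : Finset E}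
    {φ : V → ZMod 2} (hφ : ∀ e ∈ S, φ (G.a e) + φ (G.b e) + G.signBit e = 0) :
    G.BalancedOn S := by
  rintro C hCS ⟨hC, hodd⟩
  have h1 : ∑ e ∈ C, (φ (G.a e) + φ (G.b e)) = 0 := by
    simp_rw [← sum_mul_parityVec]
    rw [Finset.sum_comm]
    simp_rw [← Finset.mul_sum]
    exact Finset.sum_eq_zero fun v _ => by rw [hC.isEven v, mul_zero]
  have h2 : ∑ e ∈ C, (φ (G.a e) + φ (G.b e) + G.signBit e) = 0 :=
    Finset.sum_eq_zero fun e he => hφ e (hCS he)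
  rw [Finset.sum_add_distrib, h1, zero_add, sum_signBit, ZMod.natCast_eq_zero_iff_even] at h2
  exact Nat.not_even_iff_odd.2 hodd h2

/-- Either a system of edges has a switching potential, or it contains an even subgraph with an
odd number of negative edges. -/
lemma exists_potential_or_odd_isEven [Fintype V] [DecidableEq V] (G : SignedGraph V E)
    (S : Finset E) :
    (∃ φ : V → ZMod 2, ∀ e ∈ S, φ (G.a e) + φ (G.b e) + G.signBit e = 0) ∨
      ∃ C ⊆ S, G.IsEven C ∧ ∑ e ∈ C, G.signBit e = 1 := by
  classical
  let w : E → (V → ZMod 2) × ZMod 2 := fun e => (G.parityVec e, G.signBit e)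
  by_cases h : ((0, 1) : (V → ZMod 2) × ZMod 2) ∈ Submodule.span (ZMod 2) (w '' S)
  · right
    obtain ⟨c, hc⟩ := Submodule.mem_span_image_finset_iff_exists_fun' (ZMod 2) |>.1 h
    have key : ∀ g : E → ZMod 2,
        ∑ e ∈ S.filter (fun e => c e = 1), g e = ∑ e ∈ S, c e * g e := by
      intro g
      rw [Finset.sum_filter]
      refine Finset.sum_congr rfl fun e _ => ?_
      have hbit : ∀ x : ZMod 2, x = 0 ∨ x = 1 := by decide
      rcases hbit (c e) with h | h <;> simp [h]
    refine ⟨S.filter (fun e => c e = 1), Finset.filter_subset _ _, fun v => ?_, ?_⟩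
    · rw [key]
      simpa [w, Prod.fst_sum] using congrFun (congrArg Prod.fst hc) v
    · rw [key]
      simpa [w, Prod.snd_sum] using congrArg Prod.snd hc
  · left
    obtain ⟨f, hf, hker⟩ := Submodule.exists_le_ker_of_notMem h
    have hf1 : f (0, 1) = 1 := by
      revert hf
      generalize f (0, 1) = x
      revert x
      decide
    refine ⟨fun v => f (Pi.single v 1, 0), fun e he => ?_⟩
    have h0 : f (w e) = 0 := hker (Submodule.subset_span ⟨e, he, rfl⟩)
    have hw : w e = (Pi.single (G.a e) 1, 0) + (Pi.single (G.b e) 1, 0)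
        + G.signBit e • ((0, 1) : (V → ZMod 2) × ZMod 2) := by
      ext v <;> simp [w, parityVec, Pi.single_apply, eq_comm]
    rw [hw, map_add, map_add, map_smul, hf1] at h0
    simpa using h0

/-- In an even subgraph with no proper nonempty even subgraph, any two touched vertices are
joined by a walk. -/
lemma reflTransGen_of_minimal_isEven [DecidableEq V] (G : SignedGraph V E)
    {C : Finset E} (hC : G.IsEven C) (hmin : ∀ D ⊆ C, D.Nonempty → G.IsEven D → D = C)
    {v w : V} (hv : ∃ e ∈ C, G.a e = v ∨ G.b e = v) (hw : ∃ e ∈ C, G.a e = w ∨ G.b e = w) :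
    Relation.ReflTransGen (G.AdjIn C) v w := by
  classical
  let K : V → Prop := Relation.ReflTransGen (G.AdjIn C) v
  have hab : ∀ e ∈ C, K (G.a e) ↔ K (G.b e) := fun e he =>
    ⟨fun h => h.tail ⟨e, he, .inl ⟨rfl, rfl⟩⟩, fun h => h.tail ⟨e, he, .inr ⟨rfl, rfl⟩⟩⟩
  have hK : ∀ e ∈ C, ∀ u, (G.a e = u ∨ G.b e = u) → (K (G.a e) ↔ K u) := by
    rintro e he u (rfl | rfl)
    · rfl
    · exact hab e he
  have hD : C.filter (fun e => K (G.a e)) = C := by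
    refine hmin _ (Finset.filter_subset _ _) ?_ fun u => ?_
    · obtain ⟨e, he, h⟩ := hv
      exact ⟨e, Finset.mem_filter.2 ⟨he, (hK e he v h).2 .refl⟩⟩
    · rw [Finset.sum_filter]
      by_cases hu : K u
      · refine (Finset.sum_congr rfl fun e he => ?_).trans (hC u)
        split_ifs with h
        · rfl
        · have : ¬ (G.a e = u ∨ G.b e = u) := fun h' => h ((hK e he u h').2 hu)
          push Not at this
          simp [parityVec, this]
      · refine Finset.sum_eq_zero fun e he => ?_
        split_ifs with h
        · have : ¬ (G.a e = u ∨ G.b e = u) := fun h' => hu ((hK e he u h').1 h)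
          push Not at this
          simp [parityVec, this]
        · rfl
  obtain ⟨e, he, h⟩ := hw
  rw [← hD] at he
  obtain ⟨he, hKe⟩ := Finset.mem_filter.1 he
  exact (hK e he w h).1 hKe

/-- An even subgraph with no proper nonempty even subgraph has at most as many edges as touched
vertices. -/
lemma card_le_of_minimal_isEven [Fintype V] [DecidableEq V] (G : SignedGraph V E)
    {C : Finset E} (hne : C.Nonempty) (hmin : ∀ D ⊆ C, D.Nonempty → G.IsEven D → D = C)
    {W : Finset V} (hW : ∀ e ∈ C, G.a e ∈ W ∧ G.b e ∈ W) : C.card ≤ W.card := by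
  classical
  obtain ⟨e₀, he₀⟩ := hne
  let w₀ := G.a e₀
  have hw₀ : w₀ ∈ W := (hW e₀ he₀).1
  let P : Finset E → (W.erase w₀ → ZMod 2) := fun D v => ∑ e ∈ D, G.parityVec e v
  have hinj : Set.InjOn P ((C.erase e₀).powerset : Set (Finset E)) := by
    intro D₁ h₁ D₂ h₂ h
    simp only [Finset.coe_powerset, Set.mem_preimage, Set.mem_powerset_iff,
      Finset.coe_subset] at h₁ h₂
    have hsub : symmDiff D₁ D₂ ⊆ C.erase e₀ := fun x hx => by
      rcases Finset.mem_symmDiff.1 hx with hx | hx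
      exacts [h₁ hx.1, h₂ hx.1]
    have hsubC := hsub.trans (Finset.erase_subset e₀ C)
    have hsum : ∀ g : E → ZMod 2,
        ∑ e ∈ symmDiff D₁ D₂, g e = ∑ e ∈ D₁, g e + ∑ e ∈ D₂, g e := by
      intro g
      have hd : symmDiff D₁ D₂ = (D₁ \ D₂) ∪ (D₂ \ D₁) := rfl
      rw [hd, Finset.sum_union disjoint_sdiff_sdiff,
        ← Finset.sum_inter_add_sum_sdiff D₁ D₂ g, ← Finset.sum_inter_add_sum_sdiff D₂ D₁ g,
        Finset.inter_comm D₂ D₁]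
      linear_combination - CharTwo.add_self_eq_zero (∑ e ∈ D₁ ∩ D₂, g e)
    have hne : ∀ v, v ≠ w₀ → ∑ e ∈ symmDiff D₁ D₂, G.parityVec e v = 0 := by
      intro v hv
      by_cases hvW : v ∈ W
      · have := congrFun h ⟨v, Finset.mem_erase.2 ⟨hv, hvW⟩⟩
        simp only [P] at this
        rw [hsum, this, CharTwo.add_self_eq_zero]
      · refine Finset.sum_eq_zero fun e he => ?_
        have := hW e (hsubC he)
        have h1 : G.a e ≠ v := fun h => hvW (h ▸ this.1)
        have h2 : G.b e ≠ v := fun h => hvW (h ▸ this.2)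
        simp [parityVec, h1, h2]
    have heven : G.IsEven (symmDiff D₁ D₂) := by
      intro v
      by_cases hv : v = w₀
      · subst hv
        rw [← Finset.sum_eq_single w₀ (s := Finset.univ)
          (f := fun v => ∑ e ∈ symmDiff D₁ D₂, G.parityVec e v) (fun v _ hv => hne v hv)
          (fun h => absurd (Finset.mem_univ _) h)]
        simp_rw [sum_parityVec]
        rw [← Nat.cast_sum, sum_deg, ZMod.natCast_eq_zero_iff_even]
        exact even_two_mul _
      · exact hne v hv
    by_contra hne'
    have hDne : (symmDiff D₁ D₂).Nonempty :=
      Finset.nonempty_iff_ne_empty.2 fun h0 => hne' (symmDiff_eq_bot.1 h0)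
    have := hmin _ hsubC hDne heven
    exact Finset.notMem_erase e₀ C (hsub (this ▸ he₀))
  have hcard := Finset.card_le_card_of_injOn P (t := Finset.univ)
    (fun _ _ => Finset.mem_coe.2 (Finset.mem_univ _)) hinj
  rw [Finset.card_powerset, Finset.card_univ, Fintype.card_fun, ZMod.card,
    Fintype.card_coe, Nat.pow_le_pow_iff_right (by norm_num)] at hcard
  rw [Finset.card_erase_of_mem he₀, Finset.card_erase_of_mem hw₀] at hcard
  have : 0 < W.card := Finset.card_pos.2 ⟨_, hw₀⟩
  omega

lemma isCircuit_of_minimal_isEven [Fintype V] [DecidableEq V] (G : SignedGraph V E)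
    {C : Finset E} (hne : C.Nonempty) (hC : G.IsEven C)
    (hmin : ∀ D ⊆ C, D.Nonempty → G.IsEven D → D = C) : G.IsCircuit C := by
  classical
  refine ⟨hne, ?_, fun v w hv hw => G.reflTransGen_of_minimal_isEven hC hmin hv hw⟩
  let W : Finset V := Finset.univ.filter fun v => ∃ e ∈ C, G.a e = v ∨ G.b e = v
  have hcard : C.card ≤ W.card := G.card_le_of_minimal_isEven hne hmin fun e he =>
    ⟨Finset.mem_filter.2 ⟨Finset.mem_univ _, e, he, .inl rfl⟩,
      Finset.mem_filter.2 ⟨Finset.mem_univ _, e, he, .inr rfl⟩⟩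
  have hdeg : ∀ v ∈ W, 2 ≤ G.deg C v := by
    intro v hv
    have hpos := G.deg_pos (Finset.mem_filter.1 hv).2
    have heven := hC v
    rw [sum_parityVec, ZMod.natCast_eq_zero_iff_even] at heven
    obtain ⟨k, hk⟩ := heven
    omega
  have hsum : ∑ v ∈ W, G.deg C v = 2 * C.card := by
    rw [← G.sum_deg C]
    refine Finset.sum_subset (Finset.subset_univ _) fun v _ hv => G.deg_eq_zero fun h => ?_
    exact hv (Finset.mem_filter.2 ⟨Finset.mem_univ _, h⟩)
  have hle : ∑ v ∈ W, 2 ≤ ∑ v ∈ W, G.deg C v := Finset.sum_le_sum hdeg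
  have heq : ∑ v ∈ W, 2 = ∑ v ∈ W, G.deg C v := by
    refine le_antisymm hle ?_
    rw [hsum, Finset.sum_const, smul_eq_mul]
    omega
  exact fun v hv => ((Finset.sum_eq_sum_iff_of_le hdeg).1 heq v
    (Finset.mem_filter.2 ⟨Finset.mem_univ _, hv⟩)).symm

/-- Harary's theorem: a balanced subgraph has a switching potential. -/
lemma BalancedOn.exists_potential [Fintype V] [DecidableEq V] {G : SignedGraph V E}
    {S : Finset E} (hS : G.BalancedOn S) :
    ∃ φ : V → ZMod 2, ∀ e ∈ S, φ (G.a e) + φ (G.b e) + G.signBit e = 0 := by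
  classical
  refine (G.exists_potential_or_odd_isEven S).resolve_right ?_
  rintro ⟨C₀, hC₀S, hC₀⟩
  obtain ⟨C, hCC₀, hCmin⟩ := exists_minimal_le_of_wellFoundedLT
    (fun C : Finset E => G.IsEven C ∧ ∑ e ∈ C, G.signBit e = 1) C₀ hC₀
  obtain ⟨hC, hodd⟩ := hCmin.prop
  refine hS C (hCC₀.trans hC₀S) ⟨G.isCircuit_of_minimal_isEven ?_ hC ?_, ?_⟩
  · rw [Finset.nonempty_iff_ne_empty]
    rintro rfl
    simp at hodd
  · intro D hDC hDne hD
    have hsplit : ∀ g : E → ZMod 2, ∑ e ∈ C \ D, g e + ∑ e ∈ D, g e = ∑ e ∈ C, g e :=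
      fun g => Finset.sum_sdiff hDC
    by_cases hb : ∑ e ∈ D, G.signBit e = 1
    · exact hCmin.eq_of_le ⟨hD, hb⟩ hDC
    · have hb0 : ∑ e ∈ D, G.signBit e = 0 := by
        revert hb
        generalize ∑ e ∈ D, G.signBit e = x
        revert x
        decide
      have hCD : C \ D = C := by
        refine hCmin.eq_of_le ⟨fun v => ?_, ?_⟩ Finset.sdiff_subset
        · simpa [hD v, hC v] using hsplit (fun e => G.parityVec e v)
        · simpa [hb0, hodd] using hsplit G.signBit
      obtain ⟨x, hx⟩ := hDne
      have hxC := hDC hx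
      rw [← hCD] at hxC
      exact absurd hx (Finset.mem_sdiff.1 hxC).2
  · rw [sum_signBit] at hodd
    rw [← Nat.not_even_iff_odd, ← ZMod.natCast_eq_zero_iff_even, hodd]
    decide

/-- The rational incidence vector of an edge. -/
def incVec [DecidableEq V] (G : SignedGraph V E) (e : E) : V → ℚ :=
  Pi.single (G.a e) 1 - (G.sign e : ℚ) • Pi.single (G.b e) 1

/-- Every cut is the support, on the edges, of a linear functional. -/
lemma IsCut.exists_functional [Fintype V] [DecidableEq V] [Fintype E] [DecidableEq E]
    {G : SignedGraph V E} {B : Finset E} (hB : G.IsCut B) :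
    ∃ f : (V → ℚ) →ₗ[ℚ] ℚ, ∀ e, f (G.incVec e) ≠ 0 ↔ e ∈ B := by
  obtain ⟨-, X, -, EX, hEX, hbal, hmin, rfl⟩ := hB
  obtain ⟨φ, hφ⟩ := hbal.exists_potential
  let ψ : V → ℚ := fun v => if v ∈ X then (if φ v = 0 then 1 else -1) else 0
  refine ⟨Fintype.linearCombination ℚ ψ, fun e => ?_⟩
  have hval : Fintype.linearCombination ℚ ψ (G.incVec e)
      = ψ (G.a e) - G.sign e * ψ (G.b e) := by
    simp [incVec, map_sub, map_smul]
  have hinside : G.a e ∈ X → G.b e ∈ X →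
      (Fintype.linearCombination ℚ ψ (G.incVec e) = 0 ↔
        φ (G.a e) + φ (G.b e) + G.signBit e = 0) := by
    intro ha hb
    rw [hval]
    simp only [ψ, ha, hb, if_true, signBit]
    have hbit : ∀ x : ZMod 2, x = 0 ∨ x = 1 := by decide
    rcases G.sign_unit e with h | h <;> rcases hbit (φ (G.a e)) with hx | hx <;>
      rcases hbit (φ (G.b e)) with hy | hy <;> rw [h, hx, hy] <;> norm_num <;> decide
  rw [Finset.mem_union]
  by_cases ha : G.a e ∈ X <;> by_cases hb : G.b e ∈ X
  · have hin : e ∈ G.insideEdges X := by simp [insideEdges, ha, hb]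
    have hcr : e ∉ G.crossEdges X := by simp [crossEdges, ha, hb]
    rw [ne_eq, hinside ha hb, or_iff_right hcr]
    constructor
    · intro h
      by_contra he
      exact h (hφ e (Finset.mem_sdiff.2 ⟨hin, he⟩))
    · intro he h
      have hb' : G.BalancedOn (G.insideEdges X \ EX.erase e) := by
        refine G.balancedOn_of_potential (φ := φ) fun e' he' => ?_
        by_cases hee : e' = e
        · rw [hee]; exact h
        · refine hφ e' ?_
          simp only [Finset.mem_sdiff, Finset.mem_erase, not_and] at he' ⊢
          exact ⟨he'.1, he'.2 hee⟩
      have := hmin _ (Finset.erase_subset e EX) hb'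
      rw [← this] at he
      exact Finset.notMem_erase e EX he
  all_goals
    have hin : e ∉ EX := fun h => by simpa [insideEdges, ha, hb] using hEX h
    rw [hval]
    rcases G.sign_unit e with h | h <;>
      simp [crossEdges, ha, hb, ψ, hin, h] <;> split_ifs <;> norm_num

end SignedGraph

/-- The vectors of a finite ordered family that are not in the span of the earlier ones are at
most as many as the dimension. -/
lemma card_filter_notMem_span_le {K M ι : Type*} [Field K] [AddCommGroup M] [Module K M]
    [Module.Finite K M] [Fintype ι] [LinearOrder ι] (r : ι → M)
    [DecidablePred fun e => r e ∉ Submodule.span K (r '' Set.Iio e)] :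
    (Finset.univ.filter fun e => r e ∉ Submodule.span K (r '' Set.Iio e)).card
      ≤ Module.finrank K M := by
  classical
  set T := Finset.univ.filter fun e => r e ∉ Submodule.span K (r '' Set.Iio e) with hT
  have hli : LinearIndependent K (fun e : T => r e) := by
    rw [Fintype.linearIndependent_iff]
    intro c hc
    by_contra! hne
    have hs : (Finset.univ.filter fun e : T => c e ≠ 0).Nonempty := by
      obtain ⟨e, he⟩ := hne
      exact ⟨e, by simpa using he⟩
    obtain ⟨e, he⟩ := Finset.exists_maximal hs
    have hce : c e ≠ 0 := (Finset.mem_filter.1 he.prop).2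
    refine (Finset.mem_filter.1 e.2).2 ?_
    rw [← Finset.add_sum_erase _ _ (Finset.mem_univ e)] at hc
    have hmem : c e • r e ∈ Submodule.span K (r '' Set.Iio (e : ι)) := by
      rw [eq_neg_of_add_eq_zero_left hc]
      refine Submodule.neg_mem _ (Submodule.sum_mem _ fun x hx => ?_)
      by_cases hcx : c x = 0
      · simp [hcx]
      · refine Submodule.smul_mem _ _ (Submodule.subset_span ⟨x, ?_, rfl⟩)
        have hxe : x ≠ e := Finset.ne_of_mem_erase hx
        by_contra hlt
        have hle : e ≤ x := not_lt.1 hlt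
        exact hxe (le_antisymm (he.le_of_ge (Finset.mem_filter.2 ⟨Finset.mem_univ _, hcx⟩) hle)
          hle)
    exact (Submodule.smul_mem_iff _ hce).1 hmem
  simpa using hli.fintype_card_le_finrank

/-- If `G` is connected and unbalanced and no bond of `G` is a single
edge, then for every `i ≤ m - n` there is an `i`-element edge set containing no broken
bond. -/
theorem exists_broken_bond_free_set {V E : Type}
    [Fintype V] [DecidableEq V] [Fintype E] [LinearOrder E]
    (G : SignedGraph V E) (hconn : G.Connected) (hunb : G.Unbalanced)
    (hnosingle : ∀ e : E, ¬ G.IsBond {e})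
    (i : ℕ) (hi : i ≤ Fintype.card E - Fintype.card V) :
    ∃ F : Finset E, F.card = i ∧ G.NoBrokenBond F := by
  classical
  let T := Finset.univ.filter fun e =>
    G.incVec e ∉ Submodule.span ℚ (G.incVec '' Set.Iio e)
  have hT : T.card ≤ Fintype.card V := by
    simpa using card_filter_notMem_span_le (K := ℚ) G.incVec
  obtain ⟨F, hFT, hF⟩ := Finset.exists_subset_card_eq (s := Tᶜ) (n := i)
    (by rw [Finset.card_compl]; omega)
  refine ⟨F, hF, ?_⟩
  rintro D ⟨B, hB, hne, rfl⟩ hDF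
  have hmin : B.min' hne ∈ T := by
    refine Finset.mem_filter.2 ⟨Finset.mem_univ _, fun hspan => ?_⟩
    obtain ⟨f, hf⟩ := hB.1.exists_functional
    have hle : Submodule.span ℚ (G.incVec '' Set.Iio (B.min' hne)) ≤ LinearMap.ker f := by
      rw [Submodule.span_le]
      rintro _ ⟨e, he, rfl⟩
      by_contra h
      exact not_le.2 he (B.min'_le e ((hf e).1 h))
    exact (hf _).2 (B.min'_mem hne) (hle hspan)
  have hneq : B.min' hne ≠ B.max' hne := by
    intro h
    refine hnosingle (B.min' hne) ?_
    convert hB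
    refine (Finset.eq_singleton_iff_unique_mem.2 ⟨B.min'_mem hne, fun x hx => ?_⟩).symm
    exact le_antisymm (h ▸ B.le_max' x hx) (B.min'_le x hx)
  exact Finset.mem_compl.1 (hFT (hDF (Finset.mem_erase.2 ⟨hneq, B.min'_mem hne⟩))) hmin
end

section
/- Let P be a finite linearly ordered set, let 𝓑 be a collection of nonempty subsets of P, let Γ be an additive abelian group, and let f : 2^P → Γ be a map such that f(A) = f(A ∖ {max B}) for every B ∈ 𝓑 and every A ⊆ P with A ⊇ B, where max B is the largest element of B. Let 𝓑* be the collection of all subsets A ⊆ P such that A ⊇ B ∖ {max B} for some B ∈ 𝓑. Then Σ_{A ⊆ P} (−1)^{|A|}·f(A) = Σ_{A ⊆ P, A ∉ 𝓑*} (−1)^{|A|}·f(A), where (−1)^{|A|}·f(A) denotes f(A) if |A| is even and −f(A) if |A| is odd. -/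
/-- The maxima of those members of `B` whose broken circuit is contained in `A`. -/
def brokenMaxima {P : Type*} [LinearOrder P] (B : Set (Finset P)) (A : Finset P) : Set P :=
  {m | ∃ b ∈ B, IsGreatest (b : Set P) m ∧ b.erase m ⊆ A}

/-- Toggling the least broken maximum preserves it as the least broken maximum. -/
theorem isLeast_brokenMaxima_symmDiff {P : Type*} [LinearOrder P] {B : Set (Finset P)}
    {A : Finset P} {m : P} (h : IsLeast (brokenMaxima B A) m) :
    IsLeast (brokenMaxima B (symmDiff A {m})) m := by
  obtain ⟨⟨b, hb, hm, hbA⟩, hmin⟩ := h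
  refine ⟨⟨b, hb, hm, fun x hx => ?_⟩, ?_⟩
  · simp [Finset.mem_symmDiff, hbA hx, Finset.ne_of_mem_erase hx]
  · rintro n ⟨c, hc, hn, hcA⟩
    by_contra! hnm
    refine hnm.not_ge (hmin ⟨c, hc, hn, fun x hx => ?_⟩)
    have hxm : x ≠ m := ((hn.2 (Finset.mem_of_mem_erase hx)).trans_lt hnm).ne
    simpa [Finset.mem_symmDiff, hxm] using hcA hx

/-- Toggling one element of a finite set flips the sign `(-1) ^ A.card`. -/
theorem neg_one_pow_card_symmDiff_singleton {P : Type*} [DecidableEq P] (A : Finset P) (m : P) :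
    (-1 : ℤ) ^ (symmDiff A {m}).card = -(-1 : ℤ) ^ A.card := by
  by_cases hm : m ∈ A
  · have h : symmDiff A {m} = A.erase m := by
      ext x; by_cases hx : x = m <;> simp [Finset.mem_symmDiff, hx, hm]
    rw [h, ← Finset.card_erase_add_one hm, pow_succ]
    simp
  · have h : symmDiff A {m} = insert m A := by
      ext x; by_cases hx : x = m <;> simp [Finset.mem_symmDiff, hx, hm]
    rw [h, Finset.card_insert_of_notMem hm, pow_succ]
    simp

/-- A function insensitive to deleting the maximum of a member of `B` is insensitive to toggling
a broken maximum. -/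
theorem apply_symmDiff_of_mem_brokenMaxima {P : Type*} [LinearOrder P] {Γ : Type*}
    {B : Set (Finset P)} {f : Finset P → Γ}
    (hf : ∀ b ∈ B, ∀ m, IsGreatest (b : Set P) m → ∀ A, b ⊆ A → f A = f (A.erase m))
    {A : Finset P} {m : P} (h : m ∈ brokenMaxima B A) :
    f (symmDiff A {m}) = f A := by
  obtain ⟨b, hb, hm, hbA⟩ := h
  have hins : f (insert m A) = f (A.erase m) := by
    rw [hf b hb m hm _ (Finset.subset_insert_iff.2 hbA), Finset.erase_insert_eq_erase]
  by_cases hmA : m ∈ A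
  · have h : symmDiff A {m} = A.erase m := by
      ext x; by_cases hx : x = m <;> simp [Finset.mem_symmDiff, hx, hmA]
    rw [h, ← hins, Finset.insert_eq_self.2 hmA]
  · have h : symmDiff A {m} = insert m A := by
      ext x; by_cases hx : x = m <;> simp [Finset.mem_symmDiff, hx, hmA]
    rw [h, hins, Finset.erase_eq_of_notMem hmA]

open Classical in
/-- Dohmen–Trinks extension of Whitney's broken circuit theorem.
Let `P` be a finite linearly ordered set, `𝓑` a collection of nonempty subsets of `P`,
`Γ` an abelian group and `f : 2^P → Γ` with `f A = f (A ∖ {max b})` whenever `b ∈ 𝓑` and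
`b ⊆ A`. With `𝓑* = {A : A ⊇ b ∖ {max b} for some b ∈ 𝓑}`, the alternating sum of `f`
over all subsets equals the alternating sum over the subsets not in `𝓑*`. -/
theorem dohmen_trinks {P : Type} [Fintype P] [LinearOrder P]
    {Γ : Type} [AddCommGroup Γ]
    (B : Set (Finset P)) (hB : ∀ b ∈ B, b.Nonempty)
    (f : Finset P → Γ)
    (hf : ∀ b, ∀ hb : b ∈ B, ∀ A : Finset P, b ⊆ A →
      f A = f (A.erase (b.max' (hB b hb))))
    (Bstar : Set (Finset P))
    (hBstar : ∀ A : Finset P,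
      A ∈ Bstar ↔ ∃ b, ∃ hb : b ∈ B, b.erase (b.max' (hB b hb)) ⊆ A) :
    ∑ A : Finset P, (-1 : ℤ) ^ A.card • f A =
      ∑ A ∈ Finset.univ.filter (fun A : Finset P => A ∉ Bstar),
        (-1 : ℤ) ^ A.card • f A := by
  have hmax : ∀ b (hb : b ∈ B) m, IsGreatest (b : Set P) m → b.max' (hB b hb) = m :=
    fun b hb m hm => (b.isGreatest_max' (hB b hb)).unique hm
  have hf' : ∀ b ∈ B, ∀ m, IsGreatest (b : Set P) m → ∀ A, b ⊆ A → f A = f (A.erase m) :=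
    fun b hb m hm A hA => hmax b hb m hm ▸ hf b hb A hA
  have hmem : ∀ A, A ∈ Bstar ↔ (brokenMaxima B A).Nonempty := by
    refine fun A => (hBstar A).trans ⟨?_, ?_⟩
    · rintro ⟨b, hb, hA⟩
      exact ⟨_, b, hb, b.isGreatest_max' (hB b hb), hA⟩
    · rintro ⟨m, b, hb, hm, hA⟩
      exact ⟨b, hb, (hmax b hb m hm).symm ▸ hA⟩
  have hleast : ∀ A ∈ Bstar, ∃ m, IsLeast (brokenMaxima B A) m := fun A hA =>
    ⟨_, (wellFounded_lt.min_mem _ ((hmem A).1 hA)),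
      fun _ hn => not_lt.1 (wellFounded_lt.not_lt_min _ hn)⟩
  choose m hm using hleast
  have hmem' : ∀ A hA, symmDiff A {m A hA} ∈ Bstar := fun A hA =>
    (hmem _).2 (isLeast_brokenMaxima_symmDiff (hm A hA)).nonempty
  have hin : ∀ A ∈ Finset.univ.filter (fun A : Finset P => A ∈ Bstar), A ∈ Bstar :=
    fun A hA => (Finset.mem_filter.1 hA).2
  rw [← Finset.sum_filter_add_sum_filter_not Finset.univ (fun A : Finset P => A ∈ Bstar),
    add_eq_right]
  refine Finset.sum_involution (fun A hA => symmDiff A {m A (hin A hA)}) ?_ ?_ ?_ ?_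
  · intro A hA
    rw [neg_one_pow_card_symmDiff_singleton,
      apply_symmDiff_of_mem_brokenMaxima hf' (hm A (hin A hA)).1, neg_smul, add_neg_cancel]
  · intro A _ _ h
    simp at h
  · intro A hA
    simpa using hmem' A (hin A hA)
  · intro A hA
    have h : m _ (hmem' A (hin A hA)) = m A (hin A hA) :=
      (hm _ _).unique (isLeast_brokenMaxima_symmDiff (hm A _))
    simp [h]
end
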